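/- arXiv:1203.5022 — 3 statements merged into one kernel-verified Lean document; each statement's English description precedes it below -/
import Mathlib

section
/- Let d ≥ 1 be an integer and ℓ_1, …, ℓ_d > 0 reals such that ℓ_i²/ℓ_j² is irrational for all i ≠ j, and let Ω = (0,ℓ_1) × … × (0,ℓ_d) ⊂ ℝ^d. For nonnegative integers n_1, …, n_d define u_{n_1,…,n_d}(x_1,…,x_d) = ∏_{i=1}^d cos(π n_i x_i / ℓ_i) (under the stated irrationality condition these are, up to scalar multiples, all the Neumann Laplacian eigenfunctions of Ω). Then for every real p ≥ 1 and every nonempty open set V ⊆ Ω, the infimum over all multi-indices (n_1,…,n_d) of ‖u_{n_1,…,n_d}‖_{L_p(V)} / ‖u_{n_1,…,n_d}‖_{L_p(Ω)} is strictly positive. In particular no Neumann eigenfunction of such a rectangle-like domain is L_p-localized. -/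
open Real MeasureTheory Filter Topology

lemma aux_pointwise (p : ℝ) (hp : 1 ≤ p) (t : ℝ) :
    (1/2:ℝ)^p / 3 * (1 + 2 * Real.cos (2*t)) ≤ |Real.cos t| ^ p := by
  have hpos : (0:ℝ) < (1/2:ℝ)^p := by positivity
  rw [Real.cos_two_mul]
  by_cases h : (1/2:ℝ) ≤ |Real.cos t|
  · have h1 : (1/2:ℝ)^p ≤ |Real.cos t| ^ p := Real.rpow_le_rpow (by norm_num) h (by linarith)
    have h2 := Real.cos_sq_le_one t
    nlinarith
  · push Not at h
    have h0 : 0 ≤ |Real.cos t| ^ p := by positivity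
    have h2 : Real.cos t ^ 2 ≤ 1/4 := by
      rw [← sq_abs]; nlinarith [abs_nonneg (Real.cos t)]
    nlinarith

lemma aux_cont (p : ℝ) (hp : 1 ≤ p) (w : ℝ) :
    Continuous fun x : ℝ => |Real.cos (w * x)| ^ p := by
  refine Continuous.rpow_const (by fun_prop) (fun x => Or.inr (by linarith))

lemma aux_pos (p : ℝ) (hp : 1 ≤ p) (a b w : ℝ) (hab : a < b) (hw : 0 ≤ w) :
    0 < ∫ x in a..b, |Real.cos (w * x)| ^ p := by
  refine intervalIntegral.integral_pos hab (aux_cont p hp w).continuousOn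
    (fun x _ => by positivity) ?_
  by_contra hcon
  push Not at hcon
  have hz : ∀ x ∈ Set.Icc a b, Real.cos (w * x) = 0 := by
    intro x hx
    by_contra hne
    have := hcon x hx
    have h2 : 0 < |Real.cos (w * x)| ^ p := by positivity
    linarith
  rcases hw.eq_or_lt with h0 | hw
  · have := hz a ⟨le_rfl, hab.le⟩
    rw [← h0] at this
    simp at this
  · set h := min (b - a) (1 / w) with hh
    have hpos : 0 < h := lt_min (by linarith) (by positivity)
    have h1 := hz a ⟨le_rfl, hab.le⟩
    have h2 := hz (a + h) ⟨by linarith, by linarith [min_le_left (b - a) (1 / w)]⟩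
    rw [mul_add, Real.cos_add, h1] at h2
    have h3 : w * h ≤ 1 := by
      calc w * h ≤ w * (1 / w) := by gcongr; exact min_le_right _ _
        _ = 1 := by field_simp
    have h4 : 0 < Real.sin (w * h) :=
      Real.sin_pos_of_pos_of_lt_pi (by positivity) (by linarith [Real.pi_gt_three])
    have h5 := Real.sin_sq_add_cos_sq (w * a)
    rw [h1] at h5
    have h6 : Real.sin (w * a) = 0 := by
      have : Real.sin (w * a) * Real.sin (w * h) = 0 := by linarith
      exact (mul_eq_zero.mp this).resolve_right h4.ne'
    rw [h6] at h5
    norm_num at h5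

lemma aux_lower (p : ℝ) (hp : 1 ≤ p) (a b w : ℝ) (hab : a < b) (hw : 0 < w) :
    (1/2:ℝ)^p / 3 * ((b - a) - 2 / w) ≤ ∫ x in a..b, |Real.cos (w * x)| ^ p := by
  have h1 : ∫ x in a..b, (1/2:ℝ)^p / 3 * (1 + 2 * Real.cos (2*(w*x)))
      ≤ ∫ x in a..b, |Real.cos (w * x)| ^ p := by
    apply intervalIntegral.integral_mono_on hab.le
    · exact Continuous.intervalIntegrable (by fun_prop) _ _
    · exact (aux_cont p hp w).intervalIntegrable _ _
    · intro x _; exact aux_pointwise p hp _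
  have h2 : ∫ x in a..b, (1/2:ℝ)^p / 3 * (1 + 2 * Real.cos (2*(w*x)))
      = (1/2:ℝ)^p / 3 * (b + Real.sin (2*(w*b)) / w)
        - (1/2:ℝ)^p / 3 * (a + Real.sin (2*(w*a)) / w) := by
    apply intervalIntegral.integral_eq_sub_of_hasDerivAt
      (f := fun x => (1/2:ℝ)^p / 3 * (x + Real.sin (2*(w*x)) / w))
    · intro x _
      have h3 : HasDerivAt (fun x : ℝ => 2*(w*x)) (2*(w*1)) x :=
        ((hasDerivAt_id x).const_mul w).const_mul 2
      have := (((hasDerivAt_id x).add (h3.sin.div_const w)).const_mul ((1/2:ℝ)^p / 3))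
      have e : (1/2:ℝ)^p / 3 * (1 + 2 * Real.cos (2*(w*x)))
          = (1/2:ℝ)^p / 3 * (1 + Real.cos (2*(w*x)) * (2*(w*1)) / w) := by
        congr 2
        field_simp
      rw [e]
      exact this
    · exact Continuous.intervalIntegrable (by fun_prop) _ _
  refine le_trans ?_ h1
  rw [h2, ← mul_sub]
  refine mul_le_mul_of_nonneg_left ?_ (by positivity)
  have h4 : Real.sin (2*(w*a)) / w ≤ 1 / w := by gcongr; exact Real.sin_le_one _
  have h5 : (-1) / w ≤ Real.sin (2*(w*b)) / w := by gcongr; exact Real.neg_one_le_sin _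
  have h6 : 2 / w = 1 / w + 1 / w := by ring
  rw [neg_div] at h5
  linarith

lemma aux_uniform (p : ℝ) (hp : 1 ≤ p) (a b l : ℝ) (hab : a < b) (hl : 0 < l) :
    ∃ c : ℝ, 0 < c ∧ ∀ n : ℕ, c ≤ ∫ x in Set.Ioo a b, |Real.cos (π * n * x / l)| ^ p := by
  have key : ∀ n : ℕ, ∫ x in Set.Ioo a b, |Real.cos (π * n * x / l)| ^ p
      = ∫ x in a..b, |Real.cos ((π * n / l) * x)| ^ p := by
    intro n
    rw [intervalIntegral.integral_of_le hab.le, integral_Ioc_eq_integral_Ioo]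
    congr 1
    ext x
    rw [mul_div_right_comm]
  simp_rw [key]
  set I : ℕ → ℝ := fun n => ∫ x in a..b, |Real.cos ((π * n / l) * x)| ^ p with hI
  have hIpos : ∀ n, 0 < I n := fun n => aux_pos p hp a b _ hab (by positivity)
  obtain ⟨N, hN⟩ := exists_nat_gt (4 * l / (π * (b - a)))
  have hba : 0 < b - a := by linarith
  have hbig : ∀ n, N ≤ n → (1/2:ℝ)^p / 3 * ((b - a) / 2) ≤ I n := by
    intro n hn
    have hn' : 4 * l / (π * (b - a)) < n := hN.trans_le (by exact_mod_cast hn)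
    have hn0 : (0:ℝ) < n := lt_trans (by positivity) hn'
    refine le_trans ?_ (aux_lower p hp a b (π * n / l) hab (by positivity))
    gcongr
    have : 2 / (π * n / l) ≤ (b - a) / 2 := by
      rw [div_lt_iff₀ (by positivity)] at hn'
      rw [div_le_iff₀ (by positivity)]
      have : (b - a) / 2 * (π * n / l) = (n * (π * (b - a))) / (2 * l) := by field_simp
      rw [this, le_div_iff₀ (by positivity)]
      linarith
    linarith
  obtain ⟨m, hm, hmin⟩ := Finset.exists_min_image (Finset.range (N+1)) I ⟨0, by simp⟩
  refine ⟨min (I m) ((1/2:ℝ)^p / 3 * ((b - a) / 2)), lt_min (hIpos m) (by positivity), ?_⟩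
  intro n
  rcases le_total N n with h | h
  · exact (min_le_right _ _).trans (hbig n h)
  · exact (min_le_left _ _).trans (hmin n (by simp; omega))

lemma aux_prod (d : ℕ) (ℓ a b : Fin d → ℝ) (p : ℝ) (n : Fin d → ℕ) :
    ∫ x in Set.univ.pi fun i => Set.Ioo (a i) (b i),
      |∏ i, Real.cos (π * n i * x i / ℓ i)| ^ p
    = ∏ i, ∫ x in Set.Ioo (a i) (b i), |Real.cos (π * n i * x / ℓ i)| ^ p := by
  rw [volume_pi, Measure.restrict_pi_pi]
  rw [← integral_fintype_prod_eq_prod (𝕜 := ℝ)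
    (f := fun i (x : ℝ) => |Real.cos (π * n i * x / ℓ i)| ^ p)]
  congr 1
  ext x
  rw [Finset.abs_prod, Real.finsetProd_rpow _ _ (fun i _ => abs_nonneg _)]

open Real MeasureTheory Filter Topology

theorem no_localization_rectangle_neumann
    (d : ℕ) (hd : 1 ≤ d) (ℓ : Fin d → ℝ) (hℓ : ∀ i, 0 < ℓ i)
    (hirr : ∀ i j : Fin d, i ≠ j → Irrational (ℓ i ^ 2 / ℓ j ^ 2))
    (p : ℝ) (hp : 1 ≤ p)
    (V : Set (Fin d → ℝ)) (hVopen : IsOpen V) (hVne : V.Nonempty)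
    (hVΩ : V ⊆ Set.univ.pi fun i => Set.Ioo 0 (ℓ i)) :
    0 < sInf {r : ℝ | ∃ n : Fin d → ℕ,
      r = (∫ x in V, |∏ i, Real.cos (π * n i * x i / ℓ i)| ^ p) ^ (1 / p) /
          (∫ x in Set.univ.pi fun i => Set.Ioo 0 (ℓ i),
              |∏ i, Real.cos (π * n i * x i / ℓ i)| ^ p) ^ (1 / p)} := by
  have hp0 : 0 < p := by linarith
  obtain ⟨x₀, hx₀⟩ := hVne
  obtain ⟨ε, hε, hball⟩ := Metric.isOpen_iff.mp hVopen x₀ hx₀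
  set B : Set (Fin d → ℝ) := Set.univ.pi fun i => Set.Ioo (x₀ i - ε) (x₀ i + ε) with hB
  set Ω : Set (Fin d → ℝ) := Set.univ.pi fun i => Set.Ioo 0 (ℓ i) with hΩ
  have hBV : B ⊆ V := by
    intro x hx
    apply hball
    rw [Metric.mem_ball, dist_pi_lt_iff hε]
    intro i
    rw [← Metric.mem_ball, Real.ball_eq_Ioo]
    exact hx i (Set.mem_univ i)
  choose c hc hcI using fun i : Fin d =>
    aux_uniform p hp (x₀ i - ε) (x₀ i + ε) (ℓ i) (by linarith) (hℓ i)
  have hC : 0 < ∏ i, c i := Finset.prod_pos fun i _ => hc i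
  have hL : 0 < ∏ i, ℓ i := Finset.prod_pos fun i _ => hℓ i
  have hvolΩ : volume Ω = ENNReal.ofReal (∏ i, ℓ i) := by
    rw [hΩ, Real.volume_pi_Ioo, ENNReal.ofReal_prod_of_nonneg (fun i _ => (hℓ i).le)]
    simp
  have hbound : ∀ (n : Fin d → ℕ) (x : Fin d → ℝ),
      |∏ i, Real.cos (π * n i * x i / ℓ i)| ^ p ≤ 1 := by
    intro n x
    apply Real.rpow_le_one (abs_nonneg _) _ hp0.le
    rw [Finset.abs_prod]
    exact Finset.prod_le_one (fun i _ => abs_nonneg _) (fun i _ => Real.abs_cos_le_one _)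
  have hint : ∀ n : Fin d → ℕ, IntegrableOn
      (fun x : Fin d → ℝ => |∏ i, Real.cos (π * n i * x i / ℓ i)| ^ p) Ω := by
    intro n
    have hcont : Continuous (fun x : Fin d → ℝ => |∏ i, Real.cos (π * n i * x i / ℓ i)| ^ p) :=
      Continuous.rpow_const (by fun_prop) (fun x => Or.inr hp0.le)
    refine Measure.integrableOn_of_bounded (M := 1) (by rw [hvolΩ]; exact ENNReal.ofReal_ne_top)
      hcont.aestronglyMeasurable (Eventually.of_forall fun x => ?_)
    rw [Real.norm_of_nonneg (by positivity)]
    exact hbound n x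
  have hlow : ∀ n : Fin d → ℕ,
      ∏ i, c i ≤ ∫ x in V, |∏ i, Real.cos (π * n i * x i / ℓ i)| ^ p := by
    intro n
    calc ∏ i, c i ≤ ∫ x in B, |∏ i, Real.cos (π * n i * x i / ℓ i)| ^ p := by
          rw [hB, aux_prod]
          exact Finset.prod_le_prod (fun i _ => (hc i).le) (fun i _ => hcI i (n i))
      _ ≤ _ := by
          refine setIntegral_mono_set ((hint n).mono_set hVΩ)
            (Eventually.of_forall fun x => ?_) hBV.eventuallyLE
          show (0:ℝ) ≤ |_| ^ p
          positivity
  have hVle : ∀ n : Fin d → ℕ,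
      ∫ x in V, |∏ i, Real.cos (π * n i * x i / ℓ i)| ^ p
        ≤ ∫ x in Ω, |∏ i, Real.cos (π * n i * x i / ℓ i)| ^ p := by
    intro n
    refine setIntegral_mono_set (hint n)
      (Eventually.of_forall fun x => ?_) hVΩ.eventuallyLE
    show (0:ℝ) ≤ |_| ^ p
    positivity
  have hup : ∀ n : Fin d → ℕ,
      ∫ x in Ω, |∏ i, Real.cos (π * n i * x i / ℓ i)| ^ p ≤ ∏ i, ℓ i := by
    intro n
    have h1 : ∫ x in Ω, |∏ i, Real.cos (π * n i * x i / ℓ i)| ^ p ≤ ∫ x in Ω, (1:ℝ) := by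
      refine integral_mono (hint n) ?_ (fun x => hbound n x)
      exact integrableOn_const (by rw [hvolΩ]; exact ENNReal.ofReal_ne_top)
    refine h1.trans (le_of_eq ?_)
    simp [Measure.real, hvolΩ, hL.le]
  have hpos : 0 < (∏ i, c i) ^ (1 / p) / (∏ i, ℓ i) ^ (1 / p) := by positivity
  refine lt_of_lt_of_le hpos (le_csInf ⟨_, 0, rfl⟩ ?_)
  rintro r ⟨n, rfl⟩
  have h1 := hlow n
  have h2 := hVle n
  have h3 := hup n
  have h4 := hC.trans_le (h1.trans h2)
  exact div_le_div₀ (Real.rpow_nonneg (hC.le.trans h1) _)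
    (Real.rpow_le_rpow hC.le h1 (by positivity)) (Real.rpow_pos_of_pos h4 _)
    (Real.rpow_le_rpow h4.le h3 (by positivity))
end

section
/- For every integer n ≥ 1 and every real ε ∈ (0, 2/3), the Bessel function J_n satisfies 0 < J_n(nz) < 2^{−n^{ε}/3} for all z ∈ (0, 1 − n^{ε − 2/3}). -/
open Real

/-- The Bessel function of the first kind of order `ν`. -/
noncomputable def besselJ (ν : ℝ) (x : ℝ) : ℝ :=
  ∑' k : ℕ, ((-1 : ℝ) ^ k / ((k.factorial : ℝ) * Real.Gamma ((k : ℝ) + ν + 1))) *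
    (x / 2) ^ (2 * (k : ℝ) + ν)

/-- Absolute values of the terms of the series, with `y = x / 2`. -/
noncomputable def bterm (n : ℕ) (y : ℝ) (k : ℕ) : ℝ :=
  y ^ (2 * k + n) / ((k.factorial : ℝ) * ((n + k).factorial : ℝ))

/-- The Bessel function of integer order at `2 * y`. -/
noncomputable def bj (n : ℕ) (y : ℝ) : ℝ := ∑' k : ℕ, (-1 : ℝ) ^ k * bterm n y k

lemma besselJ_eq (n : ℕ) (x : ℝ) : besselJ n x = bj n (x / 2) := by
  unfold besselJ bj bterm
  congr 1
  funext k
  have h1 : (k : ℝ) + n + 1 = ((n + k : ℕ) : ℝ) + 1 := by push_cast; ring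
  have h2 : 2 * (k : ℝ) + n = ((2 * k + n : ℕ) : ℝ) := by push_cast; ring
  rw [h1, Real.Gamma_nat_eq_factorial, h2, Real.rpow_natCast]
  ring

lemma bterm_summable (n : ℕ) (y : ℝ) (hy : 0 < y) : Summable (bterm n y) := by
  have h := (Real.summable_pow_div_factorial (y ^ 2)).mul_left (y ^ n)
  refine Summable.of_nonneg_of_le (fun k => ?_) (fun k => ?_) h
  · unfold bterm; positivity
  · unfold bterm
    have e : y ^ n * ((y ^ 2) ^ k / (k.factorial : ℝ)) = y ^ (2 * k + n) / (k.factorial : ℝ) := by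
      rw [pow_add, pow_mul]; ring
    rw [e]
    apply div_le_div_of_nonneg_left (by positivity) (by positivity)
    have : (1 : ℝ) ≤ ((n + k).factorial : ℝ) := by exact_mod_cast Nat.factorial_pos _
    have h0 : (0 : ℝ) < (k.factorial : ℝ) := by positivity
    nlinarith

lemma bj_summable (n : ℕ) (y : ℝ) (hy : 0 < y) :
    Summable (fun k : ℕ => (-1 : ℝ) ^ k * bterm n y k) := by
  apply Summable.of_norm
  have := (bterm_summable n y hy).norm
  simpa using this

lemma bj_rec (m : ℕ) (y : ℝ) (hy : 0 < y) :
    y * bj m y + y * bj (m + 2) y = (m + 1) * bj (m + 1) y := by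
  have s1 := (bj_summable (m + 1) y hy).mul_left ((m : ℝ) + 1)
  have s0 := (bj_summable m y hy).mul_left y
  have s2 := (bj_summable (m + 2) y hy).mul_left y
  unfold bj
  rw [← tsum_mul_left, ← tsum_mul_left, ← tsum_mul_left, s1.tsum_eq_zero_add, s0.tsum_eq_zero_add,
    add_assoc, ← Summable.tsum_add ((summable_nat_add_iff 1).2 s0) s2]
  congr 1
  · simp only [bterm]
    have : ((m + 1 + 0).factorial : ℝ) = (m + 1) * (m.factorial : ℝ) := by
      rw [add_zero, Nat.factorial_succ]; push_cast; ring
    rw [this]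
    have h0 : (m.factorial : ℝ) ≠ 0 := by positivity
    have h1 : (m : ℝ) + 1 ≠ 0 := by positivity
    simp
    field_simp
    try ring
  · congr 1
    funext k
    simp only [bterm]
    have e1 : ((m + 1 + (k + 1)).factorial : ℝ) = (m + k + 2) * (m + k + 1) * ((m + k).factorial : ℝ) := by
      rw [show m + 1 + (k + 1) = (m + k + 1) + 1 by ring, Nat.factorial_succ, Nat.factorial_succ]
      push_cast; ring
    have e2 : ((m + 2 + k).factorial : ℝ) = (m + k + 2) * (m + k + 1) * ((m + k).factorial : ℝ) := by
      rw [show m + 2 + k = (m + k + 1) + 1 by ring, Nat.factorial_succ, Nat.factorial_succ]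
      push_cast; ring
    have e3 : ((m + (k + 1)).factorial : ℝ) = (m + k + 1) * ((m + k).factorial : ℝ) := by
      rw [show m + (k + 1) = (m + k) + 1 by ring, Nat.factorial_succ]
      push_cast; ring
    have e4 : ((k + 1).factorial : ℝ) = (k + 1) * (k.factorial : ℝ) := by
      rw [Nat.factorial_succ]; push_cast; ring
    rw [e1, e2, e3, e4]
    have h0 : ((m + k).factorial : ℝ) ≠ 0 := by positivity
    have h1 : (k.factorial : ℝ) ≠ 0 := by positivity
    have h2 : (m : ℝ) + k + 1 ≠ 0 := by positivity
    have h3 : (m : ℝ) + k + 2 ≠ 0 := by positivity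
    have h4 : (k : ℝ) + 1 ≠ 0 := by positivity
    field_simp
    ring

lemma bterm_antitone (m : ℕ) (y : ℝ) (hy : 0 < y) (hm : y ^ 2 ≤ m + 1) : Antitone (bterm m y) := by
  apply antitone_nat_of_succ_le
  intro k
  have e : bterm m y (k + 1) = bterm m y k * (y ^ 2 / ((k + 1) * (m + k + 1))) := by
    unfold bterm
    rw [show m + (k + 1) = (m + k) + 1 by ring, Nat.factorial_succ, Nat.factorial_succ]
    push_cast
    have h0 : ((m + k).factorial : ℝ) ≠ 0 := by positivity
    have h1 : (k.factorial : ℝ) ≠ 0 := by positivity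
    field_simp
    ring
  rw [e]
  have : 0 ≤ bterm m y k := by unfold bterm; positivity
  apply mul_le_of_le_one_right this
  rw [div_le_one (by positivity)]
  have hk : (0 : ℝ) ≤ k := by positivity
  have hm' : (0 : ℝ) ≤ m := by positivity
  nlinarith [mul_nonneg hk hm', mul_nonneg hk hk]

lemma bj_bounds (m : ℕ) (y : ℝ) (hy : 0 < y) (hm : y ^ 2 ≤ m + 1) :
    bterm m y 0 - bterm m y 1 ≤ bj m y ∧ bj m y ≤ bterm m y 0 := by
  have ht := (bj_summable m y hy).hasSum.tendsto_sum_nat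
  have ha := bterm_antitone m y hy hm
  constructor
  · have := ha.alternating_series_le_tendsto ht 1
    simp [Finset.sum_range_succ] at this
    unfold bj
    linarith
  · have := ha.tendsto_le_alternating_series ht 0
    simp [Finset.sum_range_succ] at this
    exact this

lemma bj_base (m : ℕ) (y : ℝ) (hy : 0 < y) (hm : y ^ 2 + y + 1 ≤ m) :
    0 < bj (m + 1) y ∧ bj (m + 1) y ≤ bj m y := by
  have key : ∀ p : ℕ, bterm p y 1 = bterm p y 0 * (y ^ 2 / (p + 1)) := by
    intro p
    unfold bterm
    rw [Nat.factorial_succ p, add_zero]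
    push_cast
    have h0 : (p.factorial : ℝ) ≠ 0 := by positivity
    simp
    field_simp
    try ring
  have hpos : ∀ p : ℕ, 0 < bterm p y 0 := by intro p; unfold bterm; positivity
  have k2 : bterm (m + 1) y 0 = bterm m y 0 * (y / (m + 1)) := by
    unfold bterm
    simp [Nat.factorial_succ]
    have h0 : (m.factorial : ℝ) ≠ 0 := by positivity
    field_simp
    try ring
  have b0 := bj_bounds m y hy (by linarith)
  have b1 := bj_bounds (m + 1) y hy (by push_cast; linarith)
  rw [key] at b0 b1
  have hm1 : (0 : ℝ) < m + 1 := by positivity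
  constructor
  · refine lt_of_lt_of_le ?_ b1.1
    have : y ^ 2 / (((m + 1 : ℕ) : ℝ) + 1) < 1 := by
      rw [div_lt_one (by positivity)]; push_cast; linarith
    have := hpos (m + 1)
    nlinarith
  · refine b1.2.trans (le_trans ?_ b0.1)
    rw [k2]
    have : y ^ 2 / ((m : ℝ) + 1) + y / (m + 1) ≤ 1 := by
      rw [← add_div, div_le_one hm1]; linarith
    have := hpos m
    nlinarith

lemma bj_step (m d : ℕ) (y : ℝ) (hy : 0 < y) (hm : 2 * y ≤ m + 1)
    (h : 0 < bj (m + d + 1) y ∧ bj (m + d + 1) y ≤ bj (m + d) y) :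
    0 < bj (m + 1) y ∧ bj (m + 1) y ≤ bj m y := by
  induction d generalizing m with
  | zero => exact h
  | succ d ih =>
    have h' := ih (m + 1) (by push_cast; linarith)
      (by rw [show m + 1 + d = m + (d + 1) by ring]; exact h)
    have r := bj_rec m y hy
    rw [show m + 1 + 1 = m + 2 by ring] at h'
    have p : 0 < bj (m + 1) y := h'.1.trans_le h'.2
    refine ⟨p, ?_⟩
    have : y * bj (m + 1) y ≤ y * bj m y := by nlinarith
    exact le_of_mul_le_mul_left this hy

lemma bj_pos (n : ℕ) (hn : 1 ≤ n) (y : ℝ) (hy : 0 < y) (h : 2 * y ≤ n) : 0 < bj n y := by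
  obtain ⟨m, rfl⟩ : ∃ m, n = m + 1 := ⟨n - 1, by omega⟩
  obtain ⟨d, hd⟩ := exists_nat_ge (y ^ 2 + y + 1)
  refine (bj_step m d y hy (by push_cast at h; linarith) (bj_base (m + d) y hy ?_)).1
  push_cast
  have : (0 : ℝ) ≤ m := by positivity
  linarith

lemma bj_integral (n : ℕ) (y r : ℝ) (hr : 0 < r) :
    (∮ t in C(0, r), Complex.exp (y * t) * Complex.exp (-y / t) / t ^ (n + 1))
      = 2 * π * Complex.I * (bj n y : ℂ) := by
  have H : HasSum (fun k : ℕ => ∮ t in C(0, r), ((-y : ℂ) ^ k / (k.factorial : ℂ)) *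
      (1 / t ^ (n + k + 1) * Complex.exp (y * t)))
      (∮ t in C(0, r), Complex.exp (y * t) * Complex.exp (-y / t) / t ^ (n + 1)) := by
    unfold circleIntegral
    refine intervalIntegral.hasSum_integral_of_dominated_convergence
      (fun k _ => (|y| / r) ^ k / (k.factorial : ℝ) * (r / r ^ (n + 1) * Real.exp (|y| * r)))
      (fun k => ?_) (fun k => ?_) ?_ ?_ ?_
    · apply Continuous.aestronglyMeasurable
      have hne : ∀ θ : ℝ, circleMap 0 r θ ^ (n + k + 1) ≠ 0 := fun θ =>
        pow_ne_zero _ (circleMap_ne_center hr.ne')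
      have hc : Continuous (circleMap 0 r) := continuous_circleMap 0 r
      simp only [deriv_circleMap, smul_eq_mul]
      fun_prop (disch := assumption)
    · refine Filter.Eventually.of_forall fun θ _ => ?_
      simp only [deriv_circleMap, smul_eq_mul, norm_mul, norm_div, norm_pow, norm_circleMap_zero,
        norm_neg, Complex.norm_I, Complex.norm_real, Real.norm_eq_abs, abs_of_pos hr, norm_one,
        Complex.norm_natCast, Complex.norm_exp]
      have h1 : Real.exp ((y : ℂ) * circleMap 0 r θ).re ≤ Real.exp (|y| * r) := by
        apply Real.exp_le_exp.2
        refine (Complex.re_le_norm _).trans ?_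
        simp [abs_of_pos hr]
      calc _ = (|y| / r) ^ k / (k.factorial : ℝ) * (r / r ^ (n + 1) * Real.exp ((y : ℂ) * circleMap 0 r θ).re) := by
              rw [div_pow]; field_simp; ring
        _ ≤ _ := by gcongr
    · refine Filter.Eventually.of_forall fun θ _ => ?_
      exact (Real.summable_pow_div_factorial _).mul_right _
    · simp
    · refine Filter.Eventually.of_forall fun θ _ => ?_
      have hne : circleMap 0 r θ ≠ 0 := circleMap_ne_center hr.ne'
      generalize circleMap 0 r θ = t at hne ⊢
      apply HasSum.const_smul
      have h := NormedSpace.expSeries_div_hasSum_exp (-y / t : ℂ)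
      rw [← Complex.exp_eq_exp_ℂ] at h
      have h2 := h.mul_left (Complex.exp (y * t) / t ^ (n + 1))
      have e1 : (fun i : ℕ => Complex.exp (y * t) / t ^ (n + 1) * ((-y / t : ℂ) ^ i / (i.factorial : ℂ)))
          = fun k : ℕ => ((-y : ℂ) ^ k / (k.factorial : ℂ)) *
            (1 / t ^ (n + k + 1) * Complex.exp (y * t)) := by
        funext k
        rw [div_pow]; field_simp; ring
      have e2 : Complex.exp (y * t) / t ^ (n + 1) * Complex.exp (-y / t)
          = Complex.exp (y * t) * Complex.exp (-y / t) / t ^ (n + 1) := by ring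
      rw [e1, e2] at h2
      exact h2
  have H2 : HasSum (fun k : ℕ => 2 * π * Complex.I * (((-1 : ℝ) ^ k * bterm n y k : ℝ) : ℂ))
      (∮ t in C(0, r), Complex.exp (y * t) * Complex.exp (-y / t) / t ^ (n + 1)) := by
    convert H using 1
    funext k
    rw [circleIntegral.integral_const_mul]
    have hd : DifferentiableOn ℂ (fun t : ℂ => Complex.exp (y * t)) (Metric.closedBall 0 r) := by
      fun_prop
    have c := hd.circleIntegral_one_div_sub_center_pow_smul hr (n + k)
    rw [iteratedDeriv_cexp_const_mul] at c
    simp only [sub_zero, smul_eq_mul, mul_zero, Complex.exp_zero, mul_one] at c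
    rw [c]
    unfold bterm
    push_cast
    rw [neg_pow]
    field_simp
    ring
  rw [← H2.tsum_eq, tsum_mul_left, bj, Complex.ofReal_tsum]

lemma bj_le (n : ℕ) (y r : ℝ) (hy : 0 < y) (hr : 1 ≤ r) :
    bj n y ≤ Real.exp (y * (r - 1 / r)) / r ^ n := by
  have hr0 : 0 < r := by linarith
  have h := circleIntegral.norm_integral_le_of_norm_le_const (c := 0) (R := r)
    (f := fun t : ℂ => Complex.exp (y * t) * Complex.exp (-y / t) / t ^ (n + 1))
    (C := Real.exp (y * (r - 1 / r)) / r ^ (n + 1)) hr0.le ?_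
  · rw [bj_integral n y r hr0] at h
    simp only [norm_mul, Complex.norm_I, Complex.norm_real, Complex.norm_ofNat, Real.norm_eq_abs,
      abs_of_pos Real.pi_pos, mul_one] at h
    have e : 2 * π * r * (Real.exp (y * (r - 1 / r)) / r ^ (n + 1))
      = 2 * π * (Real.exp (y * (r - 1 / r)) / r ^ n) := by
      rw [pow_succ]; field_simp
    rw [e] at h
    exact (le_abs_self _).trans (le_of_mul_le_mul_left h (by positivity))
  · intro t ht
    have hn : ‖t‖ = r := by simpa using ht
    rw [← Complex.exp_add, norm_div, norm_pow, hn, Complex.norm_exp]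
    gcongr
    have hns : Complex.normSq t = r ^ 2 := by rw [Complex.normSq_eq_norm_sq, hn]
    have e : ((y : ℂ) * t + -y / t).re = y * (t.re * (1 - 1 / r ^ 2)) := by
      simp [Complex.add_re, Complex.div_re, hns]
      ring
    rw [e]
    have h1 : t.re ≤ r := hn ▸ Complex.re_le_norm t
    have h2 : 0 ≤ 1 - 1 / r ^ 2 := by
      rw [sub_nonneg, div_le_one (by positivity)]; nlinarith
    have e3 : r - 1 / r = r * (1 - 1 / r ^ 2) := by field_simp
    rw [e3]
    gcongr

lemma sinh_bound (a : ℝ) (h0 : 0 ≤ a) (h1 : a ≤ 1) :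
    Real.exp a - Real.exp (-a) ≤ 2 * (a + 2 / 9 * a ^ 3) := by
  have p := Real.exp_bound (x := a) (by rwa [abs_of_nonneg h0]) (n := 3) (by norm_num)
  have q := Real.exp_bound (x := -a) (by rwa [abs_neg, abs_of_nonneg h0]) (n := 3) (by norm_num)
  rw [abs_neg] at q
  rw [abs_of_nonneg h0] at p q
  simp [Finset.sum_range_succ, Nat.factorial] at p q
  have := (abs_le.1 p).2
  have := (abs_le.1 q).1
  nlinarith

theorem kroger_bessel_bound (n : ℕ) (hn : 1 ≤ n) (ε : ℝ) (hε : ε ∈ Set.Ioo (0 : ℝ) (2 / 3))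
    (z : ℝ) (hz : z ∈ Set.Ioo (0 : ℝ) (1 - (n : ℝ) ^ (ε - 2 / 3))) :
    0 < besselJ n (n * z) ∧ besselJ n (n * z) < (2 : ℝ) ^ (-(n : ℝ) ^ ε / 3) := by
  obtain ⟨hz0, hz1⟩ := hz
  have hn1 : (1 : ℝ) ≤ n := by exact_mod_cast hn
  have hn0 : (0 : ℝ) < n := by linarith
  have hp : 0 < (n : ℝ) ^ (ε - 2 / 3) := by positivity
  have hy : 0 < (n : ℝ) * z / 2 := by positivity
  rw [besselJ_eq]
  refine ⟨bj_pos n hn _ hy (by nlinarith), ?_⟩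
  set a := Real.sqrt (1 - z) with ha
  have hasq : a ^ 2 = 1 - z := Real.sq_sqrt (by linarith)
  have ha0 : 0 < a := Real.sqrt_pos.2 (by linarith)
  have ha1 : a ≤ 1 := by nlinarith
  have B := bj_le n _ (Real.exp a) hy (Real.one_le_exp ha0.le)
  refine B.trans_lt ?_
  rw [← Real.exp_nat_mul, ← Real.exp_sub, Real.rpow_def_of_pos (by norm_num)]
  apply Real.exp_lt_exp.2
  rw [one_div, ← Real.exp_neg]
  have S := sinh_bound a ha0.le ha1
  have hL := Real.log_two_lt_d9
  have hL0 : 0 < Real.log 2 := Real.log_pos (by norm_num)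
  -- `n ^ ε ≤ n * a ^ 3`
  have hne : 0 < (n : ℝ) ^ ε := by positivity
  have key : (n : ℝ) ^ ε ≤ n * a ^ 3 := by
    have hb : ((n : ℝ) ^ (ε / 2 - 1 / 3)) ≤ a := by
      apply Real.le_sqrt_of_sq_le
      rw [← Real.rpow_natCast, ← Real.rpow_mul hn0.le]
      have : (ε / 2 - 1 / 3) * ((2 : ℕ) : ℝ) = ε - 2 / 3 := by push_cast; ring
      rw [this]; linarith
    have hc : ((n : ℝ) ^ (ε / 2 - 1 / 3)) ^ 3 ≤ a ^ 3 := by gcongr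
    rw [← Real.rpow_natCast, ← Real.rpow_mul hn0.le] at hc
    have hd : (n : ℝ) * (n : ℝ) ^ ((ε / 2 - 1 / 3) * ((3 : ℕ) : ℝ)) = (n : ℝ) ^ (3 * ε / 2) := by
      rw [← Real.rpow_one_add' hn0.le]
      · congr 1; push_cast; ring
      · push_cast; have := hε.1; intro h; nlinarith
    calc (n : ℝ) ^ ε ≤ (n : ℝ) ^ (3 * ε / 2) :=
          Real.rpow_le_rpow_of_exponent_le hn1 (by linarith [hε.1])
      _ = _ := hd.symm
      _ ≤ _ := by gcongr
  have ha3 : 0 < a ^ 3 := by positivity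
  have hz' : z = 1 - a ^ 2 := by linarith
  have m1 : (n : ℝ) * z / 2 * (Real.exp a - Real.exp (-a)) ≤ n * z / 2 * (2 * (a + 2 / 9 * a ^ 3)) := by
    gcongr
  have m2 : (n : ℝ) * z / 2 * (2 * (a + 2 / 9 * a ^ 3)) - n * a ≤ - (7 / 9) * (n * a ^ 3) := by
    have : (n : ℝ) * z / 2 * (2 * (a + 2 / 9 * a ^ 3)) - n * a
      = - (7 / 9) * (n * a ^ 3) - n * (2 / 9 * a ^ 5) := by rw [hz']; ring
    rw [this]
    have : 0 ≤ (n : ℝ) * (2 / 9 * a ^ 5) := by positivity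
    linarith
  have m3 : Real.log 2 * (n : ℝ) ^ ε ≤ 1 * (n : ℝ) ^ ε := by gcongr; linarith
  have m4 : Real.log 2 * (-(n : ℝ) ^ ε / 3) = -(Real.log 2 * (n : ℝ) ^ ε) / 3 := by ring
  rw [m4]
  linarith
end

section
/- For every real ν > 1 and every real ε ∈ (0, 2/3), one has 0 < √(π/(2x)) · J_ν(x) < √(π/(2ν)) · exp(2/3 − (1/3) ν^{ε}) for all x ∈ (0, ν − ν^{ε + 1/3}). (Here √(π/(2x)) · J_ν(x) is the spherical Bessel function j_{ν−1/2}(x).) -/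
open Real

open MeasureTheory in
lemma gamma_lower (ν : ℝ) (hν : 0 < ν) :
    √ν * Real.exp (ν * Real.log ν - ν) ≤ Real.Gamma (ν + 1) := by
  rw [Real.Gamma_eq_integral (by linarith)]
  have hint := Real.GammaIntegral_convergent (s := ν + 1) (by linarith)
  have hsub : Set.Ioi ν ⊆ Set.Ioi (0 : ℝ) := Set.Ioi_subset_Ioi hν.le
  have hb : 0 < 1 / (2 * ν) := by positivity
  have hpre : (fun x : ℝ => x - ν) ⁻¹' Set.Ioi 0 = Set.Ioi ν := by
    ext x; simp
  have hgi : Integrable (fun x : ℝ => Real.exp (-(1 / (2 * ν)) * (x - ν) ^ 2)) :=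
    (integrable_exp_neg_mul_sq hb).comp_sub_right ν
  have hg : ∫ x in Set.Ioi ν, Real.exp (-(1 / (2 * ν)) * (x - ν) ^ 2)
      = √(π / (1 / (2 * ν))) / 2 := by
    rw [← integral_gaussian_Ioi, ← hpre]
    exact (measurePreserving_sub_right volume ν).setIntegral_preimage_emb
      (measurableEmbedding_subRight ν) (fun x => Real.exp (-(1 / (2 * ν)) * x ^ 2)) (Set.Ioi 0)
  have h1 : ∫ x in Set.Ioi ν, Real.exp (ν * Real.log ν - ν) *
        Real.exp (-(1 / (2 * ν)) * (x - ν) ^ 2)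
      ≤ ∫ x in Set.Ioi ν, Real.exp (-x) * x ^ (ν + 1 - 1) := by
    refine setIntegral_mono_on (hgi.integrableOn.const_mul _) (hint.mono_set hsub)
      measurableSet_Ioi ?_
    intro x hx
    have hx' : ν < x := hx
    have hx0 : 0 < x := hν.trans hx'
    rw [Real.rpow_def_of_pos hx0, ← Real.exp_add, ← Real.exp_add]
    apply Real.exp_le_exp.2
    have hu : 0 ≤ (x - ν) / ν := div_nonneg (by linarith) hν.le
    have hl := Real.le_log_one_add_of_nonneg hu
    have e1 : 1 + (x - ν) / ν = x / ν := by field_simp; ring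
    rw [e1, Real.log_div hx0.ne' hν.ne'] at hl
    have h2 : (x - ν) / ν - ((x - ν) / ν) ^ 2 / 2 ≤ 2 * ((x - ν) / ν) / ((x - ν) / ν + 2) := by
      rw [le_div_iff₀ (by linarith)]
      nlinarith [pow_nonneg hu 3]
    have h3 : ν * ((x - ν) / ν - ((x - ν) / ν) ^ 2 / 2) ≤ ν * (Real.log x - Real.log ν) :=
      mul_le_mul_of_nonneg_left (h2.trans hl) hν.le
    have h4 : ν * ((x - ν) / ν - ((x - ν) / ν) ^ 2 / 2)
      = x - ν - 1 / (2 * ν) * (x - ν) ^ 2 := by field_simp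
    rw [h4] at h3
    have : ν + 1 - 1 = ν := by ring
    rw [this]
    nlinarith
  have h2 : ∫ x in Set.Ioi ν, Real.exp (-x) * x ^ (ν + 1 - 1)
      ≤ ∫ x in Set.Ioi 0, Real.exp (-x) * x ^ (ν + 1 - 1) := by
    refine setIntegral_mono_set hint ?_ hsub.eventuallyLE
    filter_upwards [ae_restrict_mem measurableSet_Ioi] with x hx
    have hx' : (0 : ℝ) < x := hx
    simp only [Pi.zero_apply]; positivity
  refine le_trans ?_ (h1.trans h2)
  rw [integral_const_mul, hg, mul_comm]
  apply mul_le_mul_of_nonneg_left _ (Real.exp_pos _).le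
  rw [le_div_iff₀ two_pos]
  apply Real.le_sqrt_of_sq_le
  rw [mul_pow, Real.sq_sqrt hν.le]
  have : π / (1 / (2 * ν)) = 2 * π * ν := by field_simp
  rw [this]
  nlinarith [Real.pi_gt_three]

/-- coefficients -/
noncomputable def bcoef (ν : ℝ) (k : ℕ) : ℝ :=
  (-1 : ℝ) ^ k / ((k.factorial : ℝ) * Real.Gamma ((k : ℝ) + ν + 1))

noncomputable def bser (ν t : ℝ) : ℝ := ∑' k : ℕ, bcoef ν k * t ^ k

lemma gamma_ge_one {y : ℝ} (hy : 2 ≤ y) : 1 ≤ Real.Gamma y := by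
  have := Real.Gamma_strictMonoOn_Ici.monotoneOn (Set.mem_Ici.2 le_rfl) (Set.mem_Ici.2 hy) hy
  rwa [Real.Gamma_two] at this

lemma bcoef_bound {ν : ℝ} (hν : 1 ≤ ν) (k : ℕ) : |bcoef ν k| ≤ 1 / k.factorial := by
  have hg : 1 ≤ Real.Gamma ((k : ℝ) + ν + 1) := gamma_ge_one (by
    have : (0 : ℝ) ≤ k := k.cast_nonneg
    linarith)
  have hf : (0 : ℝ) < k.factorial := by positivity
  unfold bcoef
  rw [abs_div, abs_pow, abs_neg, abs_one, one_pow, abs_of_pos (by positivity)]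
  apply one_div_le_one_div_of_le hf
  nlinarith

lemma bcoef_succ (ν : ℝ) (k : ℕ) :
    bcoef ν (k + 1) * ((k : ℝ) + 1) = - bcoef (ν + 1) k := by
  unfold bcoef
  have e : ((k + 1 : ℕ) : ℝ) + ν + 1 = (k : ℝ) + (ν + 1) + 1 := by push_cast; ring
  rw [e, Nat.factorial_succ]
  push_cast
  have : (k : ℝ) + 1 ≠ 0 := by positivity
  rw [pow_succ]
  field_simp

lemma bcoef_rec {ν : ℝ} (hν : 0 < ν) (k : ℕ) :
    bcoef ν k = (ν + 1 + k) * bcoef (ν + 1) k := by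
  unfold bcoef
  have hk : (0 : ℝ) ≤ k := k.cast_nonneg
  have e : (k : ℝ) + (ν + 1) + 1 = ((k : ℝ) + ν + 1) + 1 := by ring
  rw [e, Real.Gamma_add_one (s := (k : ℝ) + ν + 1) (by positivity)]
  have : Real.Gamma ((k : ℝ) + ν + 1) ≠ 0 := (Real.Gamma_pos_of_pos (by positivity)).ne'
  have h2 : (k : ℝ) + ν + 1 ≠ 0 := by positivity
  have h3 : (k.factorial : ℝ) ≠ 0 := by positivity
  generalize Real.Gamma ((k : ℝ) + ν + 1) = G at *
  have h4 : ν + 1 + (k : ℝ) = (k : ℝ) + ν + 1 := by ring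
  rw [h4]
  field_simp

lemma bser_summable {ν : ℝ} (hν : 1 ≤ ν) (t : ℝ) : Summable fun k : ℕ => bcoef ν k * t ^ k := by
  refine Summable.of_norm_bounded (Real.summable_pow_div_factorial |t|) fun k => ?_
  rw [Real.norm_eq_abs, abs_mul, abs_pow]
  have := bcoef_bound hν k
  have h2 := mul_le_mul_of_nonneg_right this (pow_nonneg (abs_nonneg t) k)
  calc _ ≤ _ := h2
    _ = _ := by ring

lemma bser_hasDerivAt {ν : ℝ} (hν : 1 ≤ ν) (t : ℝ) :
    HasDerivAt (bser ν) (-bser (ν + 1) t) t := by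
  set R := |t| + 1 with hR
  have hR0 : 0 ≤ R := by positivity
  have hu : Summable fun k : ℕ => (1 / (k.factorial : ℝ)) * (k * R ^ (k - 1)) := by
    rw [← summable_nat_add_iff 1]
    refine (Real.summable_pow_div_factorial R).congr fun k => ?_
    rw [Nat.factorial_succ]
    push_cast
    have : (k : ℝ) + 1 ≠ 0 := by positivity
    field_simp
  have key := hasDerivAt_tsum_of_isPreconnected (𝕜 := ℝ) (t := Metric.ball (0 : ℝ) R)
    (g := fun k y => bcoef ν k * y ^ k) (g' := fun k y => bcoef ν k * (k * y ^ (k - 1)))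
    (y₀ := t) (y := t) hu Metric.isOpen_ball (convex_ball _ _).isPreconnected
    (fun k y _ => (hasDerivAt_pow k y).const_mul _)
    (fun k y hy => by
      have hy' : |y| ≤ R := by
        have := mem_ball_zero_iff.1 hy
        rw [Real.norm_eq_abs] at this; exact this.le
      rw [Real.norm_eq_abs, abs_mul, abs_mul, abs_pow, Nat.abs_cast]
      have := bcoef_bound hν k
      gcongr)
    (by rw [mem_ball_zero_iff, Real.norm_eq_abs]; linarith) (bser_summable hν t)
    (by rw [mem_ball_zero_iff, Real.norm_eq_abs]; linarith)
  convert! key using 1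
  have hs : Summable fun k : ℕ => bcoef ν k * (k * t ^ (k - 1)) := by
    rw [← summable_nat_add_iff 1]
    refine (bser_summable (ν := ν + 1) (by linarith) t).neg.congr fun k => ?_
    have := bcoef_succ ν k
    simp only [Nat.add_sub_cancel]
    push_cast
    linear_combination -this * t ^ k
  rw [hs.tsum_eq_zero_add]
  simp only [Nat.cast_zero, zero_mul, mul_zero, zero_add, Nat.add_sub_cancel]
  rw [bser, ← tsum_neg]
  refine tsum_congr fun k => ?_
  have := bcoef_succ ν k
  push_cast
  linear_combination -this * t ^ k

lemma bser_rec {ν : ℝ} (hν : 1 ≤ ν) (t : ℝ) :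
    bser ν t = (ν + 1) * bser (ν + 1) t - t * bser (ν + 2) t := by
  have e : ν + 2 = ν + 1 + 1 := by ring
  have h1 := bser_summable (ν := ν + 1) (by linarith) t
  have h2 := bser_summable (ν := ν + 2) (by linarith) t
  have hs : Summable fun k : ℕ => bcoef (ν + 1) k * k * t ^ k := by
    rw [← summable_nat_add_iff 1]
    refine (h2.mul_left (-t)).congr fun k => ?_
    have := bcoef_succ (ν + 1) k
    rw [← e] at this
    push_cast
    rw [pow_succ]
    linear_combination -this * t ^ k * t
  have h3 : ∑' k : ℕ, bcoef (ν + 1) k * k * t ^ k = - t * bser (ν + 2) t := by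
    rw [hs.tsum_eq_zero_add, bser, ← tsum_mul_left]
    simp only [Nat.cast_zero, zero_mul, mul_zero, zero_add]
    refine tsum_congr fun k => ?_
    have := bcoef_succ (ν + 1) k
    rw [← e] at this
    push_cast
    rw [pow_succ]
    linear_combination this * t ^ k * t
  have h4 : bser ν t = ∑' k : ℕ, ((ν + 1) * (bcoef (ν + 1) k * t ^ k)
      + bcoef (ν + 1) k * k * t ^ k) := by
    rw [bser]
    refine tsum_congr fun k => ?_
    rw [bcoef_rec (by linarith) k]; ring
  rw [h4, (h1.mul_left _).tsum_add hs, h3, tsum_mul_left, ← bser]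
  ring

lemma besselJ_eq_s15 (ν x : ℝ) (hx : 0 < x) :
    besselJ ν x = (x / 2) ^ ν * bser ν (x ^ 2 / 4) := by
  rw [besselJ, bser, ← tsum_mul_left]
  refine tsum_congr fun k => ?_
  have hx2 : 0 < x / 2 := by positivity
  rw [bcoef, Real.rpow_add hx2, Real.rpow_mul hx2.le, Real.rpow_natCast]
  have : (x / 2) ^ (2 : ℝ) = x ^ 2 / 4 := by
    rw [Real.rpow_two]; ring
  rw [this]; ring

lemma bser_zero (ν : ℝ) : bser ν 0 = 1 / Real.Gamma (ν + 1) := by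
  rw [bser, tsum_eq_single 0]
  · simp [bcoef]
  · intro k hk; simp [hk]

noncomputable def bP (ν x : ℝ) : ℝ := bser ν (x ^ 2 / 4)
noncomputable def bQ (ν x : ℝ) : ℝ := ν * bP ν x - x ^ 2 / 2 * bP (ν + 1) x

lemma bP_hasDerivAt {ν : ℝ} (hν : 1 ≤ ν) (x : ℝ) :
    HasDerivAt (bP ν) (-(x / 2) * bP (ν + 1) x) x := by
  have h1 : HasDerivAt (fun y : ℝ => y ^ 2 / 4) (x / 2) x := by
    convert! (hasDerivAt_pow 2 x).div_const 4 using 1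
    norm_num; ring
  have := (bser_hasDerivAt hν (x ^ 2 / 4)).comp x h1
  convert! this using 1
  rw [bP]; ring

lemma bP_deriv {ν : ℝ} (hν : 1 ≤ ν) {x : ℝ} (hx : x ≠ 0) :
    HasDerivAt (bP ν) ((bQ ν x - ν * bP ν x) / x) x := by
  convert! bP_hasDerivAt hν x using 1
  rw [bQ]; field_simp; ring

lemma bQ_hasDerivAt {ν : ℝ} (hν : 1 ≤ ν) (x : ℝ) :
    HasDerivAt (bQ ν) (ν * (-(x / 2) * bP (ν + 1) x) -
      (x * bP (ν + 1) x + x ^ 2 / 2 * (-(x / 2) * bP (ν + 1 + 1) x))) x := by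
  have h1 : HasDerivAt (fun y : ℝ => y ^ 2 / 2) x x := by
    convert! (hasDerivAt_pow 2 x).div_const 2 using 1
    norm_num
  exact ((bP_hasDerivAt hν x).const_mul ν).sub
    (h1.mul (bP_hasDerivAt (ν := ν + 1) (by linarith) x))

lemma bQ_deriv {ν : ℝ} (hν : 1 ≤ ν) {x : ℝ} (hx : x ≠ 0) :
    HasDerivAt (bQ ν) (((ν ^ 2 - x ^ 2) * bP ν x - ν * bQ ν x) / x) x := by
  convert! bQ_hasDerivAt hν x using 1
  have := bser_rec hν (x ^ 2 / 4)
  rw [show ν + 2 = ν + 1 + 1 by ring] at this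
  change bP ν x = (ν + 1) * bP (ν + 1) x - x ^ 2 / 4 * bP (ν + 1 + 1) x at this
  rw [bQ, div_eq_iff hx]
  linear_combination (-x ^ 2) * this

lemma bP_cont {ν : ℝ} (hν : 1 ≤ ν) : Continuous (bP ν) :=
  continuous_iff_continuousAt.2 fun x => (bP_hasDerivAt hν x).continuousAt

lemma bQ_cont {ν : ℝ} (hν : 1 ≤ ν) : Continuous (bQ ν) :=
  continuous_iff_continuousAt.2 fun x => (bQ_hasDerivAt hν x).continuousAt

lemma bP_zero (ν : ℝ) : bP ν 0 = 1 / Real.Gamma (ν + 1) := by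
  rw [bP]; simp [bser_zero]

lemma rpow_deriv (a : ℝ) {x : ℝ} (hx : 0 < x) :
    HasDerivAt (fun y : ℝ => y ^ a) (a * x ^ a / x) x := by
  convert! Real.hasDerivAt_rpow_const (p := a) (Or.inl hx.ne') using 1
  rw [Real.rpow_sub hx, Real.rpow_one]; ring

lemma bP_pos {ν : ℝ} (hν : 1 ≤ ν) {x : ℝ} (hx0 : 0 ≤ x) (hxν : x < ν) : 0 < bP ν x := by
  have hν0 : 0 < ν := by linarith
  have hcr : Continuous fun y : ℝ => y ^ (2 * ν) :=
    Real.continuous_rpow_const (by linarith)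
  have hcP := bP_cont hν
  have hcQ := bQ_cont hν
  have h0 : (0 : ℝ) ^ (2 * ν) = 0 := Real.zero_rpow (by linarith)
  -- product is monotone
  have hM : MonotoneOn (fun y => y ^ (2 * ν) * (bP ν y * bQ ν y)) (Set.Ico 0 ν) := by
    refine monotoneOn_of_hasDerivWithinAt_nonneg (convex_Ico _ _)
      (by fun_prop)
      (f' := fun y => y ^ (2 * ν) / y * (bQ ν y ^ 2 + (ν ^ 2 - y ^ 2) * bP ν y ^ 2)) ?_ ?_
    · intro y hy
      rw [interior_Ico] at hy
      have hy0 : y ≠ 0 := hy.1.ne'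
      refine HasDerivAt.hasDerivWithinAt ?_
      convert! (rpow_deriv (2 * ν) hy.1).mul ((bP_deriv hν hy0).mul (bQ_deriv hν hy0)) using 1
      simp only [Pi.mul_apply]
      field_simp
      ring
    · intro y hy
      rw [interior_Ico] at hy
      have := hy.1
      have h2 : 0 ≤ ν ^ 2 - y ^ 2 := by nlinarith [hy.1, hy.2]
      positivity
  have hPQ : ∀ y ∈ Set.Ico 0 ν, 0 ≤ y ^ (2 * ν) * (bP ν y * bQ ν y) := by
    intro y hy
    have := hM (Set.left_mem_Ico.2 hν0) hy hy.1
    simpa [h0] using this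
  have hM2 : MonotoneOn (fun y => y ^ (2 * ν) * bP ν y ^ 2) (Set.Ico 0 ν) := by
    refine monotoneOn_of_hasDerivWithinAt_nonneg (convex_Ico _ _)
      (by fun_prop)
      (f' := fun y => 2 / y * (y ^ (2 * ν) * (bP ν y * bQ ν y))) ?_ ?_
    · intro y hy
      rw [interior_Ico] at hy
      have hy0 : y ≠ 0 := hy.1.ne'
      refine HasDerivAt.hasDerivWithinAt ?_
      convert! (rpow_deriv (2 * ν) hy.1).mul ((bP_deriv hν hy0).pow 2) using 1
      simp only [Pi.pow_apply]
      field_simp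
      ring
    · intro y hy
      rw [interior_Ico] at hy
      have := hy.1
      have := hPQ y ⟨hy.1.le, hy.2⟩
      positivity
  have hP0 : 0 < bP ν 0 := by
    rw [bP_zero]
    have : 0 < Real.Gamma (ν + 1) := Real.Gamma_pos_of_pos (by linarith)
    positivity
  have hne : ∀ y ∈ Set.Ico 0 ν, bP ν y ≠ 0 := by
    intro y hy hy0
    rcases hy.1.eq_or_lt with h | h
    · rw [← h] at hy0; exact hP0.ne' hy0
    · have hev : ∀ᶠ z in nhds (0 : ℝ), 0 < bP ν z :=
        hcP.continuousAt.eventually (lt_mem_nhds hP0)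
      obtain ⟨d, hd, hd2⟩ := Metric.eventually_nhds_iff.1 hev
      set z := min y (d / 2) with hz
      have hzpos : 0 < z := lt_min h (by positivity)
      have hzP : 0 < bP ν z := by
        apply hd2
        rw [Real.dist_eq, sub_zero, abs_of_pos hzpos]
        have := min_le_right y (d / 2)
        linarith
      have := hM2 ⟨hzpos.le, (min_le_left _ _).trans_lt hy.2⟩ hy (min_le_left _ _)
      simp only [hy0] at this
      have h3 : 0 < z ^ (2 * ν) * bP ν z ^ 2 := by positivity
      norm_num at this
      linarith
  by_contra hcon
  push Not at hcon
  obtain ⟨y, hy, hy0⟩ := intermediate_value_Icc' hx0 hcP.continuousOn ⟨hcon, hP0.le⟩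
  exact hne y ⟨hy.1, hy.2.trans_lt hxν⟩ hy0

noncomputable def bW (ν x : ℝ) : ℝ := √(ν ^ 2 - x ^ 2)
noncomputable def bK (ν x : ℝ) : ℝ :=
  Real.exp (bW ν x - ν * Real.log (ν + bW ν x) - Real.log (bW ν x) / 2)
noncomputable def bH (ν x : ℝ) : ℝ := bW ν x + x ^ 2 / (2 * bW ν x ^ 2)

lemma bW_sq_pos {ν x : ℝ} (hx : x ∈ Set.Ico 0 ν) : 0 < ν ^ 2 - x ^ 2 := by
  nlinarith [hx.1, hx.2]

lemma bW_pos {ν x : ℝ} (hx : x ∈ Set.Ico 0 ν) : 0 < bW ν x := Real.sqrt_pos.2 (bW_sq_pos hx)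

lemma bW_sq {ν x : ℝ} (hx : x ∈ Set.Ico 0 ν) : bW ν x ^ 2 = ν ^ 2 - x ^ 2 :=
  Real.sq_sqrt (bW_sq_pos hx).le

lemma bW_deriv {ν x : ℝ} (hx : x ∈ Set.Ico 0 ν) :
    HasDerivAt (bW ν) (-x / bW ν x) x := by
  have h1 : HasDerivAt (fun y : ℝ => ν ^ 2 - y ^ 2) (-(2 * x)) x := by
    convert! (hasDerivAt_pow 2 x).const_sub (ν ^ 2) using 1
    norm_num
  convert! h1.sqrt (bW_sq_pos hx).ne' using 1
  have := bW_pos hx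
  change _ = -(2 * x) / (2 * bW ν x)
  field_simp

lemma bK_deriv {ν x : ℝ} (hν : 0 < ν) (hx : x ∈ Set.Ioo 0 ν) :
    HasDerivAt (bK ν) (bK ν x * ((bH ν x - ν) / x)) x := by
  have hx' : x ∈ Set.Ico 0 ν := ⟨hx.1.le, hx.2⟩
  have hw := bW_pos hx'
  have hw2 := bW_sq hx'
  have hd := bW_deriv hx'
  have hx0 : x ≠ 0 := hx.1.ne'
  have h1 := ((hd.sub (((hd.const_add ν).log (by positivity)).const_mul ν)).sub
    ((hd.log hw.ne').div_const 2)).exp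
  convert! h1 using 1
  change bK ν x * _ = bK ν x * _
  congr 1
  rw [bH]
  have h5 : ν + bW ν x ≠ 0 := by positivity
  field_simp
  have e : x ^ 2 = ν ^ 2 - bW ν x ^ 2 := by linarith
  rw [e]
  ring

lemma bH_deriv {ν x : ℝ} (hx : x ∈ Set.Ioo 0 ν) :
    HasDerivAt (bH ν) ((-x ^ 2 / bW ν x + x ^ 2 / bW ν x ^ 2 + x ^ 4 / bW ν x ^ 4) / x) x := by
  have hx' : x ∈ Set.Ico 0 ν := ⟨hx.1.le, hx.2⟩
  have hw := bW_pos hx'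
  have hd := bW_deriv hx'
  have hx0 : x ≠ 0 := hx.1.ne'
  have h1 := hd.add ((hasDerivAt_pow 2 x).div ((hd.pow 2).const_mul 2)
    (by simp only [Pi.pow_apply]; positivity))
  convert! h1 using 1
  simp only [Pi.pow_apply]
  field_simp
  norm_num
  ring

lemma bW_cont (ν : ℝ) : Continuous (bW ν) := by unfold bW; fun_prop

lemma bK_cont {ν : ℝ} (hν : 0 < ν) : ContinuousOn (bK ν) (Set.Ico 0 ν) := by
  intro x hx
  have hw := bW_pos hx
  have hc := (bW_cont ν).continuousAt (x := x)
  refine ContinuousAt.continuousWithinAt ?_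
  unfold bK
  refine Real.continuous_exp.continuousAt.comp ?_
  refine ((hc.sub (((continuousAt_const.add hc).log (add_pos hν hw).ne').const_mul ν))).sub
    ((hc.log hw.ne').div_const 2)

lemma bH_cont {ν : ℝ} : ContinuousOn (bH ν) (Set.Ico 0 ν) := by
  intro x hx
  have hw := bW_pos hx
  have hc := (bW_cont ν).continuousAt (x := x)
  refine ContinuousAt.continuousWithinAt ?_
  unfold bH
  exact hc.add (ContinuousAt.div (by fun_prop) (by fun_prop) (by positivity))

lemma bQ_le {ν : ℝ} (hν : 1 ≤ ν) {x : ℝ} (hx : x ∈ Set.Ioo 0 ν) :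
    bQ ν x ≤ bH ν x * bP ν x := by
  have hν0 : 0 < ν := by linarith
  have hcr : Continuous fun y : ℝ => y ^ (2 * ν) :=
    Real.continuous_rpow_const (by linarith)
  have hcP := bP_cont hν
  have hcQ := bQ_cont hν
  have hcK := bK_cont hν0
  have hcH := bH_cont (ν := ν)
  have h0 : (0 : ℝ) ^ (2 * ν) = 0 := Real.zero_rpow (by linarith)
  have hA : AntitoneOn (fun y => y ^ (2 * ν) * (bK ν y * (bQ ν y - bH ν y * bP ν y)))
      (Set.Ico 0 ν) := by
    refine antitoneOn_of_hasDerivWithinAt_nonpos (convex_Ico _ _)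
      (hcr.continuousOn.mul (hcK.mul (hcQ.continuousOn.sub (hcH.mul hcP.continuousOn))))
      (f' := fun y => -(y ^ (2 * ν) / y * (bK ν y * ((y ^ 2 / bW ν y ^ 2
        + 5 / 4 * y ^ 4 / bW ν y ^ 4) * bP ν y)))) ?_ ?_
    · intro y hy
      rw [interior_Ico] at hy
      have hy' : y ∈ Set.Ico 0 ν := ⟨hy.1.le, hy.2⟩
      have hy0 : y ≠ 0 := hy.1.ne'
      have hw := bW_pos hy'
      have hw2 := bW_sq hy'
      refine HasDerivAt.hasDerivWithinAt ?_
      convert! (rpow_deriv (2 * ν) hy.1).mul ((bK_deriv hν0 hy).mul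
        ((bQ_deriv hν hy0).sub ((bH_deriv hy).mul (bP_deriv hν hy0)))) using 1
      simp only [Pi.mul_apply, Pi.sub_apply]
      rw [← hw2, bH]
      field_simp
      ring
    · intro y hy
      rw [interior_Ico] at hy
      have := hy.1
      have hw := bW_pos (ν := ν) ⟨hy.1.le, hy.2⟩
      have hP := bP_pos hν hy.1.le hy.2
      have : 0 < bK ν y := Real.exp_pos _
      rw [neg_nonpos]
      positivity
  have := hA (Set.left_mem_Ico.2 hν0) (⟨hx.1.le, hx.2⟩ : x ∈ Set.Ico 0 ν) hx.1.le
  simp only [h0, zero_mul] at this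
  have hxp : 0 < x ^ (2 * ν) * bK ν x := mul_pos (Real.rpow_pos_of_pos hx.1 _) (Real.exp_pos _)
  rw [← mul_assoc] at this
  by_contra hcon
  push Not at hcon
  nlinarith [mul_pos hxp (sub_pos.2 hcon)]

lemma bP_le {ν : ℝ} (hν : 1 ≤ ν) {x : ℝ} (hx : x ∈ Set.Ioo 0 ν) :
    bP ν x / bK ν x ≤ bP ν 0 / bK ν 0 := by
  have hν0 : 0 < ν := by linarith
  have hkp : ∀ y, 0 < bK ν y := fun y => Real.exp_pos _
  have hA : AntitoneOn (fun y => bP ν y / bK ν y) (Set.Ico 0 ν) := by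
    refine antitoneOn_of_hasDerivWithinAt_nonpos (convex_Ico _ _)
      ((bP_cont hν).continuousOn.div (bK_cont hν0) (fun y _ => (hkp y).ne'))
      (f' := fun y => -((bH ν y * bP ν y - bQ ν y) / (y * bK ν y))) ?_ ?_
    · intro y hy
      rw [interior_Ico] at hy
      have hy0 : y ≠ 0 := hy.1.ne'
      refine HasDerivAt.hasDerivWithinAt ?_
      convert! (bP_deriv hν hy0).div (bK_deriv hν0 hy) (hkp y).ne' using 1
      have := (hkp y).ne'
      field_simp
      ring
    · intro y hy
      rw [interior_Ico] at hy
      have := hy.1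
      have := hkp y
      rw [neg_nonpos]
      exact div_nonneg (sub_nonneg.2 (bQ_le hν hy)) (by positivity)
  exact hA (Set.left_mem_Ico.2 hν0) ⟨hx.1.le, hx.2⟩ hx.1.le

lemma besselJ_pos' {ν : ℝ} (hν : 1 ≤ ν) {x : ℝ} (hx : x ∈ Set.Ioo 0 ν) : 0 < besselJ ν x := by
  rw [besselJ_eq_s15 ν x hx.1]
  exact mul_pos (Real.rpow_pos_of_pos (by linarith [hx.1]) _) (bP_pos hν hx.1.le hx.2)

lemma besselJ_le {ν : ℝ} (hν : 1 ≤ ν) {x : ℝ} (hx : x ∈ Set.Ioo 0 ν) :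
    besselJ ν x ≤ Real.exp (ν * Real.log x + (bW ν x - ν * Real.log (ν + bW ν x)
      - Real.log (bW ν x) / 2)) := by
  have hν0 : 0 < ν := by linarith
  have h1 := bP_le hν hx
  have hkp : ∀ y, 0 < bK ν y := fun y => Real.exp_pos _
  have hG := gamma_lower ν hν0
  have hw0 : bW ν 0 = ν := by
    rw [bW]; simp [Real.sqrt_sq hν0.le]
  have hG0 : 0 < Real.Gamma (ν + 1) := Real.Gamma_pos_of_pos (by linarith)
  have hk0 : bK ν 0 = Real.exp (ν - ν * Real.log 2 - ν * Real.log ν) / √ν := by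
    rw [bK, hw0, Real.sqrt_eq_rpow, Real.rpow_def_of_pos hν0, ← Real.exp_sub,
      show ν + ν = 2 * ν by ring, Real.log_mul two_ne_zero hν0.ne']
    congr 1; ring
  have h2 : bP ν 0 / bK ν 0 ≤ Real.exp (ν * Real.log 2) := by
    rw [div_le_iff₀ (hkp 0), bP_zero, hk0, div_le_iff₀ hG0, mul_div_assoc', ← Real.exp_add]
    have hs : 0 < √ν := Real.sqrt_pos.2 hν0
    rw [div_mul_eq_mul_div, le_div_iff₀ hs, one_mul]
    have := mul_le_mul_of_nonneg_left hG
      (Real.exp_pos (ν * Real.log 2 + (ν - ν * Real.log 2 - ν * Real.log ν))).le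
    refine le_trans (le_of_eq ?_) this
    rw [mul_left_comm, ← Real.exp_add]
    ring_nf
    simp
  have h3 : bP ν x ≤ Real.exp (ν * Real.log 2) * bK ν x := by
    rw [← div_le_iff₀ (hkp x)]; exact h1.trans h2
  rw [besselJ_eq_s15 ν x hx.1, Real.rpow_def_of_pos (by linarith [hx.1] : 0 < x / 2),
    Real.log_div hx.1.ne' two_ne_zero]
  refine (mul_le_mul_of_nonneg_left h3 (Real.exp_pos _).le).trans (le_of_eq ?_)
  rw [bK, ← Real.exp_add, ← Real.exp_add]
  congr 1
  ring

lemma log_cubic {r : ℝ} (h0 : 0 ≤ r) (h1 : r < 1) :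
    2 * r + 2 / 3 * r ^ 3 ≤ Real.log (1 + r) - Real.log (1 - r) := by
  have h := Real.hasSum_log_sub_log_of_abs_lt_one (x := r) (by rwa [abs_of_nonneg h0])
  have := sum_le_hasSum (Finset.range 2) (fun k _ => by positivity) h
  refine le_trans (le_of_eq ?_) this
  norm_num [Finset.sum_range_succ]
  try ring

/-- The final elementary inequality. -/
lemma final_ineq {ν m r s : ℝ} (hm : 1 ≤ m) (hνm : ν = m ^ 3) (h0 : 0 < r) (h1 : r < 1)
    (hs : s < m ^ 2 * r ^ 2) :
    -(Real.log (1 - r) + Real.log (1 + r)) / 4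
      + (ν / 2 * (Real.log (1 - r) - Real.log (1 + r)) + ν * r) < 2 / 3 - s / 3 := by
  have hc := log_cubic h0.le h1
  have hl1 : Real.log (1 - r) ≤ -r := by
    have := Real.log_le_sub_one_of_pos (by linarith : 0 < 1 - r); linarith
  have hl2 := Real.le_log_one_add_of_nonneg h0.le
  have hl3 : r - 1 / 3 ≤ Real.log (1 + r) := by
    refine le_trans ?_ hl2
    rw [le_div_iff₀ (by linarith)]
    nlinarith
  have hν1 : 1 ≤ ν := by rw [hνm]; exact one_le_pow₀ hm
  have hA : (ν - 1) * (2 * r + 2 / 3 * r ^ 3) ≤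
      (ν - 1) * (Real.log (1 + r) - Real.log (1 - r)) :=
    mul_le_mul_of_nonneg_left hc (by linarith)
  have hz : m ^ 2 * r ^ 2 ≤ 1 / 4 + m ^ 3 * r ^ 3 := by
    have hz0 : 0 < m * r := by positivity
    nlinarith [mul_nonneg hz0.le (sq_nonneg (m * r - 1 / 2)), sq_nonneg (m * r - 2 / 3), sq_nonneg (m * r)]
  have hr2 : r ^ 2 ≤ 1 := by nlinarith
  have hr3 : r ^ 3 ≤ 1 := by nlinarith [pow_pos h0 2]
  have hν3 : ν * r ^ 3 = m ^ 3 * r ^ 3 := by rw [hνm]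
  nlinarith

theorem spherical_bessel_bound_nu (ν ε : ℝ) (hν : 1 < ν) (hε : ε ∈ Set.Ioo (0 : ℝ) (2 / 3))
    (x : ℝ) (hx : x ∈ Set.Ioo (0 : ℝ) (ν - ν ^ (ε + 1 / 3))) :
    0 < Real.sqrt (π / (2 * x)) * besselJ ν x ∧
      Real.sqrt (π / (2 * x)) * besselJ ν x <
        Real.sqrt (π / (2 * ν)) * Real.exp (2 / 3 - ν ^ ε / 3) := by
  obtain ⟨hx0, hx1⟩ := hx
  have hν0 : 0 < ν := by linarith
  have hadd : ν ^ (ε + 1 / 3) = ν ^ ε * ν ^ (1 / 3 : ℝ) := Real.rpow_add hν0 _ _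
  set m := ν ^ (1 / 3 : ℝ) with hm
  set s := ν ^ ε with hs
  have hm1 : 1 ≤ m := Real.one_le_rpow hν.le (by norm_num)
  have hs1 : 1 ≤ s := Real.one_le_rpow hν.le hε.1.le
  have hνm : ν = m ^ 3 := by
    rw [hm, ← Real.rpow_natCast, ← Real.rpow_mul hν0.le]; norm_num
  have hsm : 1 ≤ s * m := one_le_mul_of_one_le_of_one_le hs1 hm1
  rw [hadd] at hx1
  have hxν : x < ν := by linarith
  have hxI : x ∈ Set.Ioo 0 ν := ⟨hx0, hxν⟩
  have hJ := besselJ_pos' hν.le hxI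
  have hpi := Real.pi_pos
  refine ⟨by positivity, ?_⟩
  have hle := besselJ_le hν.le hxI
  have hwp := bW_pos (ν := ν) (x := x) ⟨hx0.le, hxν⟩
  have hw2 := bW_sq (ν := ν) (x := x) ⟨hx0.le, hxν⟩
  set w := bW ν x
  have hw1 : 1 ≤ w := by nlinarith
  have hwν : w < ν := by nlinarith
  set r := w / ν with hr
  have hr0 : 0 < r := by positivity
  have hr1 : r < 1 := (div_lt_one hν0).2 hwν
  have hwr : w = ν * r := by rw [hr]; field_simp
  have hxr : x ^ 2 = ν ^ 2 * ((1 - r) * (1 + r)) := by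
    rw [hwr] at hw2; linarith
  have hsr : s < m ^ 2 * r ^ 2 := by
    have h1 : ν * (s * m) < ν * (ν * r ^ 2) := by
      have : ν * (ν * r ^ 2) = (ν - x) * (ν + x) := by
        rw [hwr] at hw2; linarith
      rw [this]; nlinarith
    have h2 : s * m < ν * r ^ 2 := lt_of_mul_lt_mul_left h1 hν0.le
    rw [hνm] at h2
    have h3 : m * s < m * (m ^ 2 * r ^ 2) := by linarith
    exact lt_of_mul_lt_mul_left h3 (by linarith)
  have hfin := final_ineq hm1 hνm hr0 hr1 hsr
  have hlx : Real.log x = Real.log ν + (Real.log (1 - r) + Real.log (1 + r)) / 2 := by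
    have h := congrArg Real.log hxr
    have a : 1 - r ≠ 0 := by linarith
    have b : 1 + r ≠ 0 := by linarith
    rw [Real.log_mul (by positivity) (mul_ne_zero a b), Real.log_mul a b, Real.log_pow,
      Real.log_pow] at h
    push_cast at h
    linarith
  have hlw : Real.log (ν + w) = Real.log ν + Real.log (1 + r) := by
    rw [← Real.log_mul hν0.ne' (by linarith), hwr]; ring_nf
  have hlw1 : 0 ≤ Real.log w := Real.log_nonneg hw1
  have hsq : √(π / (2 * x)) = √(π / (2 * ν)) * Real.exp ((Real.log ν - Real.log x) / 2) := by
    have e : π / (2 * x) = π / (2 * ν) * (ν / x) := by field_simp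
    rw [e, Real.sqrt_mul (by positivity)]
    congr 1
    rw [Real.sqrt_eq_rpow, Real.rpow_def_of_pos (by positivity), Real.log_div hν0.ne' hx0.ne']
    congr 1; ring
  rw [hsq, mul_assoc]
  have hsp : 0 < √(π / (2 * ν)) := by positivity
  refine mul_lt_mul_of_pos_left ?_ hsp
  refine (mul_le_mul_of_nonneg_left hle (Real.exp_pos _).le).trans_lt ?_
  rw [← Real.exp_add]
  apply Real.exp_lt_exp.2
  rw [hlx, hlw]
  nlinarith
end
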